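/- arXiv:2508.06977 — 2 statements merged into one kernel-verified Lean document; each statement's English description precedes it below -/
import Mathlib

section
/- Let P_ℓ denote the path graph on ℓ ≥ 2 vertices and let p, q ≥ 1 be integers. Then hom(K_{p,q}, P_ℓ) = (ℓ − 2)·(2^p + 2^q − 2) + 2. -/
open SimpleGraph

/-- Pairs of maps into a path on `k + 2` vertices forming a homomorphism of the complete bipartite
graph on `α` and `β`, and such that the largest vertex used is attained on `α`. -/
abbrev TopOnLeft (α β : Type*) (k : ℕ) : Type _ :=
  {x : (α → Fin (k + 2)) × (β → Fin (k + 2)) //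
    (∀ i j, (pathGraph (k + 2)).Adj (x.1 i) (x.2 j)) ∧ ∃ i, ∀ j, x.2 j < x.1 i}

/-- The pair of maps whose left part takes the values `m + 2` and `m` as prescribed by `s`, and
whose right part is constant equal to `m + 1`; `none` is sent to the pair of constant maps
`1` and `0`. -/
def topOnLeftOfOption (α β : Type*) [Nonempty α] (k : ℕ) :
    Option (Fin k × {s : α → Bool // ∃ i, s i = true}) → TopOnLeft α β k
  | none => ⟨(fun _ ↦ 1, fun _ ↦ 0), by simp [pathGraph_adj], by simp⟩
  | some (m, s) =>
    ⟨(fun i ↦ if s.1 i then ⟨m + 2, by omega⟩ else ⟨m, by omega⟩, fun _ ↦ ⟨m + 1, by omega⟩), by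
      refine ⟨fun i j ↦ ?_, ?_⟩
      · by_cases h : s.1 i <;> simp [pathGraph_adj, h]
      · obtain ⟨i, hi⟩ := s.2
        exact ⟨i, by simp [hi]⟩⟩

theorem topOnLeftOfOption_injective (α β : Type*) [Nonempty α] [Nonempty β] (k : ℕ) :
    Function.Injective (topOnLeftOfOption α β k) := by
  obtain ⟨j⟩ := ‹Nonempty β›
  rintro (_ | ⟨m, s⟩) (_ | ⟨n, t⟩) h
  · rfl
  · have := congrArg (fun x ↦ (x.1.2 j).val) h
    simp [topOnLeftOfOption] at this
  · have := congrArg (fun x ↦ (x.1.2 j).val) h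
    simp [topOnLeftOfOption] at this
  · have hmn : m = n := by
      have := congrArg (fun x ↦ (x.1.2 j).val) h
      simp only [topOnLeftOfOption] at this
      omega
    subst hmn
    have hst : s = t := by
      ext i : 2
      have := congrArg (fun x ↦ (x.1.1 i).val) h
      cases hs : s.1 i <;> cases ht : t.1 i <;> simp [topOnLeftOfOption, hs, ht] at this ⊢
    rw [hst]

theorem topOnLeftOfOption_surjective (α β : Type*) [Nonempty α] [Nonempty β] (k : ℕ) :
    Function.Surjective (topOnLeftOfOption α β k) := by
  rintro ⟨⟨f, g⟩, hadj, i₀, hi₀⟩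
  obtain ⟨j₀⟩ := ‹Nonempty β›
  simp only [pathGraph_adj, Fin.lt_def] at hadj hi₀
  have hM := (f i₀).isLt
  have hj₀ := hi₀ j₀
  by_cases h1 : (f i₀).val = 1
  · refine ⟨none, Subtype.ext (Prod.ext (funext fun i ↦ Fin.ext ?_) (funext fun j ↦ Fin.ext ?_))⟩
    · have := hadj i j₀
      simp only [topOnLeftOfOption, Fin.val_one]
      omega
    · have := hi₀ j
      simp only [topOnLeftOfOption, Fin.val_zero]
      omega
  · have h2 : 2 ≤ (f i₀).val := by omega
    refine ⟨some (⟨(f i₀).val - 2, by omega⟩, ⟨fun i ↦ decide (f i = f i₀), i₀, by simp⟩),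
      Subtype.ext (Prod.ext (funext fun i ↦ Fin.ext ?_) (funext fun j ↦ Fin.ext ?_))⟩
    · have := hadj i j₀
      have := hadj i₀ j₀
      by_cases h : f i = f i₀
      · simp only [topOnLeftOfOption, h, decide_true, if_true]
        omega
      · simp only [topOnLeftOfOption, h, decide_false, Bool.false_eq_true, if_false]
        rw [Fin.ext_iff] at h
        omega
    · have := hi₀ j
      have := hadj i₀ j
      simp only [topOnLeftOfOption]
      omega

theorem card_exists_eq_true (α : Type*) [Fintype α] :
    Nat.card {s : α → Bool // ∃ i, s i = true} = 2 ^ Fintype.card α - 1 := by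
  classical
  have h : ∀ s : α → Bool, (∃ i, s i = true) ↔ ¬ s = fun _ ↦ false := by
    intro s
    simp [funext_iff]
  rw [Nat.card_congr (Equiv.subtypeEquivRight h), Nat.card_eq_fintype_card,
    Fintype.card_subtype_compl, Fintype.card_subtype_eq]
  simp

theorem card_topOnLeft (α β : Type*) [Fintype α] [Nonempty α] [Nonempty β] (k : ℕ) :
    Nat.card (TopOnLeft α β k) = k * (2 ^ Fintype.card α - 1) + 1 := by
  rw [← Nat.card_congr (Equiv.ofBijective _
    ⟨topOnLeftOfOption_injective α β k, topOnLeftOfOption_surjective α β k⟩),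
    Finite.card_option, Nat.card_prod, card_exists_eq_true, Nat.card_fin]

/-- A homomorphism from a complete bipartite graph to a graph `G` is a pair of maps
with all pairs of values adjacent. -/
def completeBipartiteGraphHomEquiv (α β : Type*) {V : Type*} (G : SimpleGraph V) :
    (completeBipartiteGraph α β →g G) ≃
      {x : (α → V) × (β → V) // ∀ i j, G.Adj (x.1 i) (x.2 j)} where
  toFun φ := ⟨(φ ∘ Sum.inl, φ ∘ Sum.inr), fun i j ↦ φ.map_rel (by simp)⟩
  invFun x := ⟨Sum.elim x.1.1 x.1.2, by
    rintro (i | i) (j | j) h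
    · simp at h
    · exact x.2 i j
    · exact (x.2 j i).symm
    · simp at h⟩
  left_inv φ := by
    ext (i | i) <;> rfl
  right_inv _ := rfl

theorem not_exists_forall_lt_iff {α β : Type*} [Nonempty α] [Nonempty β] {n : ℕ}
    {f : α → Fin n} {g : β → Fin n} (h : ∀ i j, (pathGraph n).Adj (f i) (g j)) :
    (¬ ∃ i, ∀ j, g j < f i) ↔ ∃ j, ∀ i, f i < g j := by
  simp only [pathGraph_adj] at h
  simp only [Fin.lt_def]
  constructor
  · intro hn
    by_contra! hc
    obtain ⟨j₀⟩ := ‹Nonempty β›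
    obtain ⟨i, hi⟩ := hc j₀
    push Not at hn
    obtain ⟨j, hj⟩ := hn i
    obtain ⟨i', hi'⟩ := hc j
    have := h i j₀
    have := h i j
    have := h i' j
    have := h i' j₀
    omega
  · rintro ⟨j, hj⟩ ⟨i, hi⟩
    exact absurd (hj i) (by have := hi j; omega)

/-- A homomorphism from a complete bipartite graph to a path attains its largest value on exactly
one side. -/
theorem card_completeBipartiteGraph_hom_pathGraph (α β : Type*) [Fintype α] [Fintype β]
    [Nonempty α] [Nonempty β] (k : ℕ) :
    Nat.card (completeBipartiteGraph α β →g pathGraph (k + 2)) =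
      Nat.card (TopOnLeft α β k) + Nat.card (TopOnLeft β α k) := by
  classical
  rw [Nat.card_congr (completeBipartiteGraphHomEquiv α β _),
    ← Nat.card_congr (Equiv.sumCompl fun x : {x : (α → Fin (k + 2)) × (β → Fin (k + 2)) //
      ∀ i j, (pathGraph (k + 2)).Adj (x.1 i) (x.2 j)} ↦ ∃ i, ∀ j, x.1.2 j < x.1.1 i),
    Nat.card_sum]
  congr 1
  · exact Nat.card_congr (Equiv.subtypeSubtypeEquivSubtypeInter
      (fun x : (α → Fin (k + 2)) × (β → Fin (k + 2)) ↦
        ∀ i j, (pathGraph (k + 2)).Adj (x.1 i) (x.2 j))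
      (fun x ↦ ∃ i, ∀ j, x.2 j < x.1 i))
  · refine Nat.card_congr ((Equiv.subtypeEquivRight fun x ↦ not_exists_forall_lt_iff x.2).trans
      ((Equiv.subtypeSubtypeEquivSubtypeInter
        (fun x : (α → Fin (k + 2)) × (β → Fin (k + 2)) ↦
          ∀ i j, (pathGraph (k + 2)).Adj (x.1 i) (x.2 j))
        (fun x ↦ ∃ j, ∀ i, x.1 i < x.2 j)).trans
      ((Equiv.prodComm _ _).subtypeEquiv fun x ↦ and_congr_left' ?_)))
    exact ⟨fun h j i ↦ (h i j).symm, fun h i j ↦ (h j i).symm⟩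

/-- The number of homomorphisms from `K_{p,q}` to the path graph on `ℓ ≥ 2` vertices
equals `(ℓ − 2)(2^p + 2^q − 2) + 2`. -/
theorem hom_count_completeBipartite_to_path (l p q : ℕ)
    (hl : 2 ≤ l) (hp : 1 ≤ p) (hq : 1 ≤ q) :
    Nat.card (completeBipartiteGraph (Fin p) (Fin q) →g SimpleGraph.pathGraph l) =
      (l - 2) * (2 ^ p + 2 ^ q - 2) + 2 := by
  obtain ⟨k, rfl⟩ := Nat.exists_eq_add_of_le' hl
  have : Nonempty (Fin p) := ⟨⟨0, hp⟩⟩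
  have : Nonempty (Fin q) := ⟨⟨0, hq⟩⟩
  rw [card_completeBipartiteGraph_hom_pathGraph, card_topOnLeft, card_topOnLeft,
    Fintype.card_fin, Fintype.card_fin, Nat.add_sub_cancel]
  have h1 := Nat.one_le_two_pow (n := p)
  have h2 := Nat.one_le_two_pow (n := q)
  have h3 : 2 ^ p + 2 ^ q - 2 = (2 ^ p - 1) + (2 ^ q - 1) := by omega
  rw [h3]
  ring
end

section
/- Let G be a finite simple bipartite graph with a bipartition into partite sets of sizes n1 and n2, with edge density δ = |E(G)|/(n1·n2) and δ > 0. Then for all positive integers p, q, the homomorphism densities satisfy t(K_{p,q}, G) ≥ δ^{pq}·t(K_{p,q}, K_{n1,n2}). -/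
open Finset

/-- A graph `G` on the vertex set `α ⊕ β` is bipartite with respect to the fixed
bipartition `(α, β)`: every edge joins the left side to the right side. -/
def IsBipartitionedGraph {α β : Type*} (G : SimpleGraph (α ⊕ β)) : Prop :=
  ∀ u v, G.Adj u v →
    ((∃ x, u = Sum.inl x) ∧ (∃ y, v = Sum.inr y)) ∨
    ((∃ x, u = Sum.inr x) ∧ (∃ y, v = Sum.inl y))

/-- The homomorphism density `t(F,G) = hom(F,G) / |V(G)|^{|V(F)|}`. -/
noncomputable def homDensity {α β : Type*} [Fintype α] [Fintype β]
    (F : SimpleGraph α) (G : SimpleGraph β) : ℝ :=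
  (Nat.card (F →g G) : ℝ) / (Fintype.card β : ℝ) ^ (Fintype.card α)

/-- The power mean inequality for a sum over a finite type. -/
theorem card_mul_mean_pow_le_sum_pow {ι : Type*} [Fintype ι] [Nonempty ι] (f : ι → ℝ)
    (hf : ∀ i, 0 ≤ f i) {k : ℕ} (hk : 1 ≤ k) :
    (Fintype.card ι : ℝ) * ((∑ i, f i) / Fintype.card ι) ^ k ≤ ∑ i, f i ^ k := by
  obtain ⟨k, rfl⟩ := Nat.exists_eq_add_of_le' hk
  have hc : (Fintype.card ι : ℝ) ≠ 0 := by exact_mod_cast Fintype.card_ne_zero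
  calc (Fintype.card ι : ℝ) * ((∑ i, f i) / Fintype.card ι) ^ (k + 1)
      = (∑ i, f i) ^ (k + 1) / (#(univ : Finset ι) : ℝ) ^ k := by
        rw [card_univ, div_pow]; field_simp; ring
    _ ≤ _ := pow_sum_div_card_le_sum_pow (fun i _ => hf i) k

/-- The Sidorenko inequality for complete bipartite graphs, for nonnegative weights. -/
theorem mean_pow_mul_le_sum_prod {α β : Type*} [Fintype α] [Fintype β] [Nonempty α] [Nonempty β]
    (a : α → β → ℝ) (ha : ∀ x y, 0 ≤ a x y) {p q : ℕ} (hp : 1 ≤ p) (hq : 1 ≤ q) :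
    ((∑ x, ∑ y, a x y) / ((Fintype.card α : ℝ) * Fintype.card β)) ^ (p * q) *
        ((Fintype.card α : ℝ) ^ p * (Fintype.card β : ℝ) ^ q) ≤
      ∑ g : Fin q → β, ∑ f : Fin p → α, ∏ i, ∏ j, a (f i) (g j) := by
  have hα : (Fintype.card α : ℝ) ≠ 0 := by exact_mod_cast Fintype.card_ne_zero
  have hβ : (Fintype.card β : ℝ) ≠ 0 := by exact_mod_cast Fintype.card_ne_zero
  have hcodeg : (Fintype.card α : ℝ) * ((∑ x, ∑ y, a x y) / Fintype.card α) ^ q ≤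
      ∑ g : Fin q → β, ∑ x, ∏ j, a x (g j) := by
    rw [sum_comm (s := (univ : Finset (Fin q → β)))]
    rw [sum_congr rfl fun x _ => (Fintype.sum_pow (a x) q).symm]
    exact card_mul_mean_pow_le_sum_pow _ (fun x => sum_nonneg fun y _ => ha x y) hq
  have hpow := card_mul_mean_pow_le_sum_pow (fun g : Fin q → β => ∑ x, ∏ j, a x (g j))
    (fun g => sum_nonneg fun x _ => prod_nonneg fun j _ => ha x (g j)) hp
  simp_rw [Fintype.sum_pow] at hpow
  refine le_trans ?_ hpow
  have hE : 0 ≤ ∑ x, ∑ y, a x y := sum_nonneg fun x _ => sum_nonneg fun y _ => ha x y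
  calc _ = (Fintype.card (Fin q → β) : ℝ) *
        (((Fintype.card α : ℝ) * ((∑ x, ∑ y, a x y) / Fintype.card α) ^ q) /
          Fintype.card (Fin q → β)) ^ p := by
        simp only [Fintype.card_fun, Fintype.card_fin, Nat.cast_pow, div_pow, mul_pow, ← pow_mul,
          mul_comm q p]
        field_simp
    _ ≤ _ := by gcongr

/-- The pairs of tuples spanning a complete bipartite pattern in the relation `R`. -/
abbrev BicliqueTuples {α β : Type*} (R : α → β → Prop) (p q : ℕ) : Type _ :=
  {fg : (Fin p → α) × (Fin q → β) // ∀ i j, R (fg.1 i) (fg.2 j)}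

theorem density_pow_mul_le_card_bicliqueTuples {α β : Type*} [Fintype α] [Fintype β]
    [Nonempty α] [Nonempty β] (R : α → β → Prop) [∀ x y, Decidable (R x y)]
    {p q : ℕ} (hp : 1 ≤ p) (hq : 1 ≤ q) :
    ((#{xy : α × β | R xy.1 xy.2} : ℝ) / ((Fintype.card α : ℝ) * Fintype.card β)) ^ (p * q) *
        ((Fintype.card α : ℝ) ^ p * (Fintype.card β : ℝ) ^ q) ≤
      Nat.card (BicliqueTuples R p q) := by
  convert mean_pow_mul_le_sum_prod (fun x y => if R x y then (1 : ℝ) else 0)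
    (fun x y => by positivity) hp hq using 1
  · rw [← Fintype.sum_prod_type', sum_boole]
  · rw [sum_comm, ← Fintype.sum_prod_type', Nat.card_eq_fintype_card, Fintype.card_subtype]
    rw [← sum_boole]
    refine sum_congr rfl fun fg _ => ?_
    rw [prod_congr rfl fun i _ => Fintype.prod_boole]
    convert (Fintype.prod_boole (p := fun i => ∀ j, R (fg.1 i) (fg.2 j))).symm

theorem card_bicliqueTuples_of_forall {α β : Type*} [Fintype α] [Fintype β] {R : α → β → Prop}
    (hR : ∀ x y, R x y) (p q : ℕ) :
    Nat.card (BicliqueTuples R p q) = Fintype.card α ^ p * Fintype.card β ^ q :=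
  (Nat.card_congr (Equiv.subtypeUnivEquiv fun _ _ _ => hR _ _)).trans (by simp)

/-- A homomorphism from `K_{p,q}` assembled from its values on the two partite sets. -/
def completeBipartiteHom {V : Type*} {G : SimpleGraph V} {p q : ℕ} (f : Fin p → V) (g : Fin q → V)
    (h : ∀ i j, G.Adj (f i) (g j)) : completeBipartiteGraph (Fin p) (Fin q) →g G where
  toFun := Sum.elim f g
  map_rel' := by
    rintro (i | j) (i' | j') hadj <;> simp at hadj
    · exact h _ _
    · exact (h _ _).symm

/-- A homomorphism from `K_{p,q}` to a bipartitioned graph either preserves or swaps the sides. -/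
theorem card_completeBipartiteGraph_hom {α β : Type*} [Fintype α] [Fintype β]
    {G : SimpleGraph (α ⊕ β)} (hG : IsBipartitionedGraph G) {p q : ℕ} (hp : 1 ≤ p) (hq : 1 ≤ q) :
    Nat.card (completeBipartiteGraph (Fin p) (Fin q) →g G) =
      Nat.card (BicliqueTuples (fun x y => G.Adj (Sum.inl x) (Sum.inr y)) p q) +
        Nat.card (BicliqueTuples (fun y x => G.Adj (Sum.inr y) (Sum.inl x)) p q) := by
  rw [← Nat.card_sum]
  symm
  let i₀ : Fin p := ⟨0, hp⟩
  let j₀ : Fin q := ⟨0, hq⟩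
  refine Nat.card_congr (Equiv.ofBijective (Sum.elim
    (fun s => completeBipartiteHom (Sum.inl ∘ s.1.1) (Sum.inr ∘ s.1.2) s.2)
    (fun s => completeBipartiteHom (Sum.inr ∘ s.1.1) (Sum.inl ∘ s.1.2) s.2)) ⟨?_, ?_⟩)
  · rintro (⟨⟨f, g⟩, h⟩ | ⟨⟨f, g⟩, h⟩) (⟨⟨f', g'⟩, h'⟩ | ⟨⟨f', g'⟩, h'⟩) heq <;>
      have hl := fun i => DFunLike.congr_fun heq (Sum.inl i) <;>
      have hr := fun j => DFunLike.congr_fun heq (Sum.inr j) <;>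
      simp [completeBipartiteHom] at hl hr
    · obtain rfl : f = f' := funext hl
      obtain rfl : g = g' := funext hr
      rfl
    · exact (hl i₀).elim
    · exact (hl i₀).elim
    · obtain rfl : f = f' := funext hl
      obtain rfl : g = g' := funext hr
      rfl
  · intro φ
    have hadj : ∀ i j, G.Adj (φ (Sum.inl i)) (φ (Sum.inr j)) := fun i j =>
      φ.map_rel (by simp)
    rcases hG _ _ (hadj i₀ j₀) with ⟨⟨x, hx⟩, ⟨y, hy⟩⟩ | ⟨⟨y, hy⟩, ⟨x, hx⟩⟩
    · have hl : ∀ i, ∃ x, φ (Sum.inl i) = Sum.inl x := fun i => by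
        rcases hG _ _ (hadj i j₀) with ⟨h, -⟩ | ⟨-, z, hz⟩
        · exact h
        · simp [hy] at hz
      have hr : ∀ j, ∃ y, φ (Sum.inr j) = Sum.inr y := fun j => by
        rcases hG _ _ (hadj i₀ j) with ⟨-, h⟩ | ⟨⟨z, hz⟩, -⟩
        · exact h
        · simp [hx] at hz
      choose f hf using hl
      choose g hg using hr
      refine ⟨Sum.inl ⟨(f, g), fun i j => by simpa only [hf, hg] using hadj i j⟩, ?_⟩
      ext (i | j)
      · exact (hf i).symm
      · exact (hg j).symm
    · have hl : ∀ i, ∃ y, φ (Sum.inl i) = Sum.inr y := fun i => by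
        rcases hG _ _ (hadj i j₀) with ⟨-, z, hz⟩ | ⟨h, -⟩
        · simp [hx] at hz
        · exact h
      have hr : ∀ j, ∃ x, φ (Sum.inr j) = Sum.inl x := fun j => by
        rcases hG _ _ (hadj i₀ j) with ⟨⟨z, hz⟩, -⟩ | ⟨-, h⟩
        · simp [hy] at hz
        · exact h
      choose f hf using hl
      choose g hg using hr
      refine ⟨Sum.inr ⟨(f, g), fun i j => by simpa only [hf, hg] using hadj i j⟩, ?_⟩
      ext (i | j)
      · exact (hf i).symm
      · exact (hg j).symm

theorem isBipartitionedGraph_completeBipartiteGraph (α β : Type*) :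
    IsBipartitionedGraph (completeBipartiteGraph α β) := by
  rintro (x | y) (x' | y') h <;> simp at h ⊢

theorem card_edgeFinset_le_card_filter {α β : Type*} [Fintype α] [Fintype β]
    [DecidableEq α] [DecidableEq β] {G : SimpleGraph (α ⊕ β)} [DecidableRel G.Adj]
    (hG : IsBipartitionedGraph G) :
    #G.edgeFinset ≤ #{xy : α × β | G.Adj (Sum.inl xy.1) (Sum.inr xy.2)} := by
  refine (card_le_card fun e he => ?_).trans
    (card_image_le (f := fun xy : α × β => s(Sum.inl xy.1, Sum.inr xy.2)))
  induction e with
  | _ u v =>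
    have huv : G.Adj u v := by simpa using he
    rw [mem_image]
    rcases hG u v huv with ⟨⟨x, rfl⟩, ⟨y, rfl⟩⟩ | ⟨⟨y, rfl⟩, ⟨x, rfl⟩⟩
    · exact ⟨(x, y), by simpa using huv, rfl⟩
    · exact ⟨(x, y), by simpa using huv.symm, Sym2.eq_swap⟩

/-- For a bipartite graph `G` with partite sets of sizes `n1, n2` and edge density
`δ = |E(G)|/(n1 n2) > 0`, and all positive integers `p, q`,
`t(K_{p,q}, G) ≥ δ^{pq} t(K_{p,q}, K_{n1,n2})`. -/
theorem homDensity_completeBipartite_ge {α β : Type*} [Fintype α] [Fintype β]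
    [DecidableEq α] [DecidableEq β]
    (G : SimpleGraph (α ⊕ β)) [DecidableRel G.Adj] (hbip : IsBipartitionedGraph G)
    (n1 n2 : ℕ) (hn1 : n1 = Fintype.card α) (hn2 : n2 = Fintype.card β)
    (δ : ℝ) (hδ : δ = (G.edgeFinset.card : ℝ) / ((n1 : ℝ) * (n2 : ℝ))) (hδpos : 0 < δ)
    (p q : ℕ) (hp : 1 ≤ p) (hq : 1 ≤ q) :
    homDensity (completeBipartiteGraph (Fin p) (Fin q)) G ≥
      δ ^ (p * q) *
        homDensity (completeBipartiteGraph (Fin p) (Fin q))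
          (completeBipartiteGraph (Fin n1) (Fin n2)) := by
  subst hn1 hn2
  have hcard : (Fintype.card α : ℝ) * Fintype.card β ≠ 0 := by
    intro h
    simp [hδ, h] at hδpos
  have : Nonempty α := Fintype.card_pos_iff.mp <| Nat.pos_of_ne_zero fun h => hcard (by simp [h])
  have : Nonempty β := Fintype.card_pos_iff.mp <| Nat.pos_of_ne_zero fun h => hcard (by simp [h])
  have hedge : (#G.edgeFinset : ℝ) ≤ #{xy : α × β | G.Adj (Sum.inl xy.1) (Sum.inr xy.2)} := by
    exact_mod_cast card_edgeFinset_le_card_filter hbip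
  have hswap : #{xy : α × β | G.Adj (Sum.inl xy.1) (Sum.inr xy.2)} =
      #{yx : β × α | G.Adj (Sum.inr yx.1) (Sum.inl yx.2)} :=
    card_equiv (Equiv.prodComm α β) fun xy => by simp [G.adj_comm]
  have hforward : δ ^ (p * q) * ((Fintype.card α : ℝ) ^ p * (Fintype.card β : ℝ) ^ q) ≤
      Nat.card (BicliqueTuples (fun x y => G.Adj (Sum.inl x) (Sum.inr y)) p q) := by
    refine le_trans ?_ (density_pow_mul_le_card_bicliqueTuples _ hp hq)
    rw [hδ]
    gcongr
  have hbackward : δ ^ (p * q) * ((Fintype.card β : ℝ) ^ p * (Fintype.card α : ℝ) ^ q) ≤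
      Nat.card (BicliqueTuples (fun y x => G.Adj (Sum.inr y) (Sum.inl x)) p q) := by
    refine le_trans ?_ (density_pow_mul_le_card_bicliqueTuples _ hp hq)
    rw [hδ, ← hswap, mul_comm (Fintype.card β : ℝ)]
    gcongr
  have hcomplete := card_completeBipartiteGraph_hom
    (isBipartitionedGraph_completeBipartiteGraph (Fin (Fintype.card α)) (Fin (Fintype.card β)))
    hp hq
  rw [card_bicliqueTuples_of_forall (by simp), card_bicliqueTuples_of_forall (by simp)] at hcomplete
  simp only [Fintype.card_fin] at hcomplete
  rw [ge_iff_le, homDensity, homDensity, card_completeBipartiteGraph_hom hbip hp hq, hcomplete,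
    mul_div_assoc']
  simp only [Fintype.card_sum, Fintype.card_fin]
  push_cast
  gcongr
  linarith
end
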